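/- Let d be a squarefree integer, let ℓ be an odd prime with ℓ ∣ d and ℓ ∤ p, let r, t, ε be integers with ε² = 1 and d·r² = 2p + ε·t. Then ℓ divides t² − 4p² (so ℓ is a volcanic prime for the curve), and ℓ divides d·(d·r² − 4p) exactly once (ℓ ∣ d·(d r² − 4p) but ℓ² ∤ d·(d r² − 4p)); i.e., ℓ ∥ Δ_ψ. -/

import Mathlib

/-- Odd primes ℓ dividing d (d squarefree, ℓ ∤ p) are volcanic for a
d-admissible curve, and ℓ divides Δ_ψ = d·(d r² − 4p) exactly once. -/
theorem stmt_13 (d p r t ε : ℤ) (ℓ : ℕ) (hd : Squarefree d)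
    (hℓ : Nat.Prime ℓ) (hodd : ℓ ≠ 2) (hℓd : (ℓ : ℤ) ∣ d) (hℓp : ¬ (ℓ : ℤ) ∣ p)
    (hε : ε ^ 2 = 1) (h : d * r ^ 2 = 2 * p + ε * t) :
    (ℓ : ℤ) ∣ t ^ 2 - 4 * p ^ 2 ∧
    (ℓ : ℤ) ∣ d * (d * r ^ 2 - 4 * p) ∧
    ¬ ((ℓ : ℤ) ^ 2 ∣ d * (d * r ^ 2 - 4 * p)) := by
  have hp : Prime (ℓ : ℤ) := Nat.prime_iff_prime_int.mp hℓ
  refine ⟨?_, hℓd.mul_right _, fun hsq => ?_⟩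
  · have key : t ^ 2 - 4 * p ^ 2 = d * (r ^ 2 * (d * r ^ 2 - 4 * p)) := by
      linear_combination (-t ^ 2) * hε + (2 * p - d * r ^ 2 - ε * t) * h
    exact key ▸ hℓd.mul_right _
  · obtain ⟨k, rfl⟩ := hℓd
    rw [pow_two, mul_assoc (ℓ : ℤ) k] at hsq
    rcases hp.dvd_or_dvd ((mul_dvd_mul_iff_left hp.ne_zero).mp hsq) with hk | hk
    · exact hp.not_isUnit (hd _ (mul_dvd_mul_left _ hk))
    · have h4 : (ℓ : ℤ) ∣ 2 ^ 2 * p := by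
        have := dvd_sub (Dvd.intro (k * r ^ 2) (mul_assoc _ _ _).symm) hk
        simpa using this
      rcases hp.dvd_or_dvd h4 with h2 | h2
      · have h2' : ℓ ∣ 2 := by exact_mod_cast hp.dvd_of_dvd_pow h2
        exact hodd ((Nat.prime_dvd_prime_iff_eq hℓ Nat.prime_two).mp h2')
      · exact hℓp h2
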